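/- Let λn, λn' ∈ ℂ be nonzero with λn² ≠ λn'², and let Q, P, Q', P' be 2×2 complex matrices. Define B(λ) = Q + (2λn/(λ² − λn²))·P and C(λ) = Q' + (2λn'/(λ² − λn'²))·P' for λ ∈ ℂ \ {±λn, ±λn'}. If B(λ)·C(λ) = I and C(λ)·B(λ) = I for all λ ∈ ℂ \ {±λn, ±λn'}, then B(λn')·P' = 0, P·C(λn) = 0, C(λn)·P = 0, and P'·B(λn') = 0. -/

import Mathlib

/-- If a product of two factors, each with at most one simple pole, is identically `1` away from
the two distinct poles, then the residues of the product vanish. -/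
theorem residue_mul_eq_zero {A : Type*} [Ring A] [Algebra ℂ A] [TopologicalSpace A] [T2Space A]
    [ContinuousAdd A] [ContinuousSMul ℂ A] {a b c d : ℂ} (hab : a ≠ b) (hc : c ≠ 0) (hd : d ≠ 0)
    {q p q' p' : A}
    (h : ∀ z : ℂ, z ≠ a → z ≠ b → (q + (c / (z - a)) • p) * (q' + (d / (z - b)) • p') = 1) :
    (q + (c / (b - a)) • p) * p' = 0 ∧ p * (q' + (d / (a - b)) • p') = 0 := by
  have hab' : a - b ≠ 0 := sub_ne_zero.mpr hab
  have hba' : b - a ≠ 0 := sub_ne_zero.mpr hab.symm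
  have cleared : (fun z : ℂ ↦ ((z - a) * (z - b)) • (q * q') + (c * (z - b)) • (p * q') +
      (d * (z - a)) • (q * p') + (c * d) • (p * p')) = fun z ↦ ((z - a) * (z - b)) • (1 : A) := by
    refine Continuous.ext_on ((Set.toFinite {a, b}).countable.dense_compl ℂ)
      (by fun_prop) (by fun_prop) fun z hz ↦ ?_
    simp only [Set.mem_compl_iff, Set.mem_insert_iff, Set.mem_singleton_iff, not_or] at hz
    have hza : z - a ≠ 0 := sub_ne_zero.mpr hz.1
    have hzb : z - b ≠ 0 := sub_ne_zero.mpr hz.2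
    simp only [← h z hz.1 hz.2, mul_add, add_mul, smul_mul_assoc, mul_smul_comm, smul_add]
    match_scalars <;> field_simp
  constructor
  · have hb := congrFun cleared b
    simp only [sub_self, mul_zero, zero_smul, zero_add] at hb
    rw [← smul_right_inj (mul_ne_zero hd hba'), smul_zero, ← hb, add_mul, smul_mul_assoc]
    match_scalars <;> field_simp
  · have ha := congrFun cleared a
    simp only [sub_self, mul_zero, zero_mul, zero_smul, zero_add, add_zero] at ha
    rw [← smul_right_inj (mul_ne_zero hc hab'), smul_zero, ← ha, mul_add, mul_smul_comm]
    match_scalars <;> field_simp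

theorem stmt2 (ln ln' : ℂ) (hln : ln ≠ 0) (hln' : ln' ≠ 0) (hne : ln ^ 2 ≠ ln' ^ 2)
    (Q P Q' P' : Matrix (Fin 2) (Fin 2) ℂ)
    (hBC : ∀ lam : ℂ, lam ≠ ln → lam ≠ -ln → lam ≠ ln' → lam ≠ -ln' →
      (Q + (2 * ln / (lam ^ 2 - ln ^ 2)) • P) * (Q' + (2 * ln' / (lam ^ 2 - ln' ^ 2)) • P') = 1 ∧
      (Q' + (2 * ln' / (lam ^ 2 - ln' ^ 2)) • P') * (Q + (2 * ln / (lam ^ 2 - ln ^ 2)) • P) = 1) :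
    (Q + (2 * ln / (ln' ^ 2 - ln ^ 2)) • P) * P' = 0 ∧
    P * (Q' + (2 * ln' / (ln ^ 2 - ln' ^ 2)) • P') = 0 ∧
    (Q' + (2 * ln' / (ln ^ 2 - ln' ^ 2)) • P') * P = 0 ∧
    P' * (Q + (2 * ln / (ln' ^ 2 - ln ^ 2)) • P) = 0 := by
  have lift (z : ℂ) (hz : z ≠ ln ^ 2) (hz' : z ≠ ln' ^ 2) :
      (Q + (2 * ln / (z - ln ^ 2)) • P) * (Q' + (2 * ln' / (z - ln' ^ 2)) • P') = 1 ∧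
      (Q' + (2 * ln' / (z - ln' ^ 2)) • P') * (Q + (2 * ln / (z - ln ^ 2)) • P) = 1 := by
    obtain ⟨w, rfl⟩ := IsAlgClosed.exists_pow_nat_eq z two_pos
    rw [Ne, sq_eq_sq_iff_eq_or_eq_neg, not_or] at hz hz'
    exact hBC w hz.1 hz.2 hz'.1 hz'.2
  have h2 : 2 * ln ≠ 0 := mul_ne_zero two_ne_zero hln
  have h2' : 2 * ln' ≠ 0 := mul_ne_zero two_ne_zero hln'
  obtain ⟨hBP', hPC⟩ := residue_mul_eq_zero hne h2 h2' fun z hz hz' ↦ (lift z hz hz').1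
  obtain ⟨hCP, hP'B⟩ := residue_mul_eq_zero hne.symm h2' h2 fun z hz' hz ↦ (lift z hz hz').2
  exact ⟨hBP', hPC, hCP, hP'B⟩
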